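/- Let k be a field, V a vector superspace over k, and x an odd nilpotent endomorphism of V. Then V is a direct sum of x-invariant graded subspaces U (U = (U ∩ V₀) ⊕ (U ∩ V₁)) such that each pair (U, x|_U) is isomorphic to Π^ε M_n for some n ≥ 0 and ε ∈ {0,1}. [Classification of finite-dimensional representations of the supergroup 𝔾_a^{(1|1)}: every representation decomposes into the indecomposables M_n and their parity shifts.] -/

import Mathlib

open scoped TensorProduct

section Defs

variable (k : Type*) [Field k]

def IsEvenMap {V : Type*} [AddCommGroup V] [Module k V]
    (V0 V1 : Submodule k V) (f : V →ₗ[k] V) : Prop :=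
  (∀ v ∈ V0, f v ∈ V0) ∧ (∀ v ∈ V1, f v ∈ V1)

def IsOddMap {V : Type*} [AddCommGroup V] [Module k V]
    (V0 V1 : Submodule k V) (f : V →ₗ[k] V) : Prop :=
  (∀ v ∈ V0, f v ∈ V1) ∧ (∀ v ∈ V1, f v ∈ V0)

/-- The shift endomorphism of the string module `M_n`: sends basis vector `a_j` to `a_{j+1}`,
and `a_n` to `0`.  In coordinates, `(x f) j = f (j-1)` for `j ≥ 1` and `(x f) 0 = 0`. -/
def shiftMap (n : ℕ) : (Fin (n+1) → k) →ₗ[k] (Fin (n+1) → k) where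
  toFun f := fun j =>
    if (j : ℕ) = 0 then 0 else f ⟨(j : ℕ) - 1, Nat.lt_of_le_of_lt (Nat.sub_le _ _) j.isLt⟩
  map_add' f g := by
    funext j; by_cases h : (j : ℕ) = 0 <;> simp only [h, ↓reduceIte, Pi.add_apply, add_zero]
  map_smul' c f := by
    funext j; by_cases h : (j : ℕ) = 0 <;>
      simp only [h, ↓reduceIte, Pi.smul_apply, RingHom.id_apply, smul_zero]

/-- The even (`r = 0`) resp. odd (`r = 1`) part of the string module `Π^ε M_n`:
coordinates `j` with `(j + ε) % 2 = r`. -/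
def stringPart (n ε r : ℕ) : Submodule k (Fin (n+1) → k) :=
  Submodule.pi Set.univ (fun j => if ((j : ℕ) + ε) % 2 = r then (⊤ : Submodule k k) else ⊥)

/-- Isomorphism of pairs (vector superspace with endomorphism): an even linear isomorphism
intertwining the endomorphisms. -/
def PairIso {V : Type*} [AddCommGroup V] [Module k V]
    (V0 V1 : Submodule k V) (x : V →ₗ[k] V)
    {W : Type*} [AddCommGroup W] [Module k W]
    (W0 W1 : Submodule k W) (y : W →ₗ[k] W) : Prop :=
  ∃ φ : V ≃ₗ[k] W, (∀ v ∈ V0, φ v ∈ W0) ∧ (∀ v ∈ V1, φ v ∈ W1) ∧ ∀ v, φ (x v) = y (φ v)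

/-- `V` decomposes as a direct sum of `x`-invariant graded subspaces, each isomorphic as a pair
to some `Π^ε M_n` with `P n`. -/
def DecomposesIntoStrings {V : Type*} [AddCommGroup V] [Module k V]
    (V0 V1 : Submodule k V) (x : V →ₗ[k] V) (P : ℕ → Prop) : Prop :=
  ∃ (m : ℕ) (U : Fin m → Submodule k V), DirectSum.IsInternal U ∧
    ∀ i : Fin m, (U i = (U i ⊓ V0) ⊔ (U i ⊓ V1)) ∧
      ∃ (hx : ∀ v ∈ U i, x v ∈ U i) (n ε : ℕ), ε ≤ 1 ∧ P n ∧
        PairIso k (V0.comap (U i).subtype) (V1.comap (U i).subtype) (x.restrict hx)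
          (stringPart k n ε 0) (stringPart k n ε 1) (shiftMap k n)

/-- A pair `(V, x)` (odd nilpotent `x`) is neat if it decomposes into strings `Π^ε M_{2s}`. -/
def IsNeat {V : Type*} [AddCommGroup V] [Module k V]
    (V0 V1 : Submodule k V) (x : V →ₗ[k] V) : Prop :=
  DecomposesIntoStrings k V0 V1 x (fun n => Even n)

end Defs

section Helpers

variable {k : Type*} [Field k] {V : Type*} [AddCommGroup V] [Module k V]

/-- A graded invariant subspace isomorphic to a string. -/
def IsStr (V0 V1 : Submodule k V) (x : V →ₗ[k] V) (U : Submodule k V) : Prop :=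
  (U = (U ⊓ V0) ⊔ (U ⊓ V1)) ∧
      ∃ (hx : ∀ v ∈ U, x v ∈ U) (n ε : ℕ), ε ≤ 1 ∧ True ∧
        PairIso k (V0.comap U.subtype) (V1.comap U.subtype) (x.restrict hx)
          (stringPart k n ε 0) (stringPart k n ε 1) (shiftMap k n)

/-- The part of parity `p mod 2`. -/
def prt (V0 V1 : Submodule k V) (p : ℕ) : Submodule k V := if p % 2 = 0 then V0 else V1

lemma prt_pow {V0 V1 : Submodule k V} {x : V →ₗ[k] V} (hodd : IsOddMap k V0 V1 x) (i p : ℕ)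
    {v : V} (hv : v ∈ prt V0 V1 p) : (x ^ i) v ∈ prt V0 V1 (p + i) := by
  induction i with
  | zero => simpa using hv
  | succ i ih =>
    rw [pow_succ', Module.End.mul_apply]
    unfold prt at ih ⊢
    rcases Nat.mod_two_eq_zero_or_one (p + i) with h | h
    · have h' : (p + (i + 1)) % 2 ≠ 0 := by omega
      rw [if_pos h] at ih
      rw [if_neg h']
      exact hodd.1 _ ih
    · have h' : (p + (i + 1)) % 2 = 0 := by omega
      rw [if_neg (by omega)] at ih
      rw [if_pos h']
      exact hodd.2 _ ih

lemma prt_congr (V0 V1 : Submodule k V) {p q : ℕ} (h : p % 2 = q % 2) :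
    prt V0 V1 p = prt V0 V1 q := by
  unfold prt; rw [h]

lemma prt_disj {V0 V1 : Submodule k V} (hc : IsCompl V0 V1) (p : ℕ) {v : V}
    (hv : v ∈ prt V0 V1 p) (hv' : v ∈ prt V0 V1 (p + 1)) : v = 0 := by
  have hd := Submodule.disjoint_def.1 hc.disjoint
  unfold prt at hv hv'
  rcases Nat.mod_two_eq_zero_or_one p with h | h
  · rw [if_pos h] at hv
    rw [if_neg (by omega)] at hv'
    exact hd _ hv hv'
  · rw [if_neg (by omega)] at hv
    rw [if_pos (by omega)] at hv'
    exact hd _ hv' hv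

/-- The map to the string module given by a functional. -/
def strMap (x : V →ₗ[k] V) (f : V →ₗ[k] k) (n : ℕ) : V →ₗ[k] (Fin (n + 1) → k) :=
  LinearMap.pi fun j => f ∘ₗ (x ^ (n - (j : ℕ)))

lemma strMap_apply (x : V →ₗ[k] V) (f : V →ₗ[k] k) (n : ℕ) (w : V) (j : Fin (n + 1)) :
    strMap x f n w j = f ((x ^ (n - (j : ℕ))) w) := rfl

lemma strMap_shift (x : V →ₗ[k] V) (f : V →ₗ[k] k) (n : ℕ) (w : V) (hw : (x ^ (n + 1)) w = 0) :
    strMap x f n (x w) = shiftMap k n (strMap x f n w) := by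
  funext j
  simp only [shiftMap, LinearMap.coe_mk, AddHom.coe_mk, strMap_apply]
  rw [← Module.End.mul_apply, ← pow_succ]
  split_ifs with h
  · rw [h, Nat.sub_zero, hw, map_zero]
  · have : n - (j : ℕ) + 1 = n - ((j : ℕ) - 1) := by omega
    rw [this]

lemma strMap_parity {V0 V1 : Submodule k V} {x : V →ₗ[k] V} (hodd : IsOddMap k V0 V1 x)
    (f : V →ₗ[k] k) (n p q : ℕ) (hq : q ≤ 1)
    (hf : ∀ w ∈ prt V0 V1 (p + n + 1), f w = 0) (w : V) (hw : w ∈ prt V0 V1 q) :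
    strMap x f n w ∈ stringPart k n p q := by
  unfold stringPart
  rw [Submodule.mem_pi]
  intro j _
  split_ifs with h
  · trivial
  · rw [Submodule.mem_bot, strMap_apply]
    apply hf
    have := prt_pow hodd (n - j) q hw
    rwa [prt_congr V0 V1 (q := p + n + 1) (by omega)] at this

lemma comb_inj (x : V →ₗ[k] V) (f : V →ₗ[k] k) (n : ℕ) (v : V) (hv : (x ^ (n + 1)) v = 0)
    (hf : f ((x ^ n) v) ≠ 0) (c : Fin (n + 1) → k)
    (hc : strMap x f n (Fintype.linearCombination k (fun i : Fin (n + 1) => (x ^ (i : ℕ)) v) c) = 0) :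
    c = 0 := by
  have key : ∀ m : ℕ, ∀ hm : m < n + 1, c ⟨m, hm⟩ = 0 := by
    intro m
    induction m using Nat.strong_induction_on with
    | _ m ih =>
      intro hm
      have h := congrFun hc ⟨m, hm⟩
      rw [strMap_apply, Fintype.linearCombination_apply, map_sum, map_sum,
        Finset.sum_eq_single ⟨m, hm⟩] at h
      · simp only [map_smul, Pi.zero_apply, smul_eq_mul] at h
        rw [← Module.End.mul_apply, ← pow_add, Nat.sub_add_cancel (by omega)] at h
        exact (mul_eq_zero.1 h).resolve_right hf
      · intro j _ hj
        have hj' : (j : ℕ) ≠ m := fun e => hj (Fin.ext e)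
        rcases lt_or_gt_of_ne hj' with hlt | hgt
        · rw [show c j = 0 from ih j hlt j.2]; simp
        · simp only [map_smul]
          rw [← Module.End.mul_apply, ← pow_add,
            show n - m + (j : ℕ) = ((j : ℕ) - m - 1) + (n + 1) by omega, pow_add,
            Module.End.mul_apply, hv]
          simp
      · simp
  funext i
  exact key i i.2

/-- Splitting off one string. -/
lemma split_one {V0 V1 : Submodule k V} (hcompl : IsCompl V0 V1)
    {x : V →ₗ[k] V} (hodd : IsOddMap k V0 V1 x) (hnil : IsNilpotent x)
    (W : Submodule k V) (hW : ∀ w ∈ W, x w ∈ W) (hg : W ≤ (W ⊓ V0) ⊔ (W ⊓ V1)) (hne : W ≠ ⊥) :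
    ∃ U W' : Submodule k V, IsStr V0 V1 x U ∧ (∀ w ∈ W', x w ∈ W') ∧
      (W' ≤ (W' ⊓ V0) ⊔ (W' ⊓ V1)) ∧ W' < W ∧ Disjoint U W' ∧ U ⊔ W' = W := by
  classical
  have hWp : ∀ i : ℕ, ∀ w ∈ W, (x ^ i) w ∈ W := by
    intro i
    induction i with
    | zero => intro w hw; simpa using hw
    | succ i ih => intro w hw; rw [pow_succ', Module.End.mul_apply]; exact hW _ (ih w hw)
  have hex : ∃ N : ℕ, ∀ w ∈ W, (x ^ N) w = 0 := by
    obtain ⟨N, hN⟩ := hnil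
    exact ⟨N, fun w _ => by rw [hN]; rfl⟩
  obtain ⟨n, hn⟩ : ∃ n, Nat.find hex = n + 1 := by
    refine Nat.exists_eq_succ_of_ne_zero fun h0 => hne ?_
    rw [Submodule.eq_bot_iff]
    intro w hw
    have := Nat.find_spec hex w hw
    rw [h0] at this
    simpa using this
  have hzero : ∀ w ∈ W, (x ^ (n + 1)) w = 0 := by
    have := Nat.find_spec hex
    rwa [hn] at this
  obtain ⟨p, hp, v, hvW, hvp, hvn⟩ : ∃ p ≤ 1, ∃ v ∈ W, v ∈ prt V0 V1 p ∧ (x ^ n) v ≠ 0 := by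
    by_contra! hcon
    refine Nat.find_min hex (m := n) (by omega) fun w hw => ?_
    obtain ⟨a, ha, b, hb, rfl⟩ := Submodule.mem_sup.1 (hg hw)
    rw [map_add, hcon 0 (by omega) a ha.1 (by simpa [prt] using ha.2),
      hcon 1 le_rfl b hb.1 (by simpa [prt] using hb.2), add_zero]
  have hpar := prt_pow hodd n p hvp
  obtain ⟨f, hfv, hfk⟩ := Submodule.exists_le_ker_of_notMem
    (p := prt V0 V1 (p + n + 1)) (v := (x ^ n) v) fun h => hvn (prt_disj hcompl _ hpar h)
  have hfk' : ∀ w ∈ prt V0 V1 (p + n + 1), f w = 0 := fun w hw => LinearMap.mem_ker.1 (hfk hw)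
  set F := strMap x f n with hF
  have hF0 : ∀ w ∈ V0, F w ∈ stringPart k n p 0 := fun w hw =>
    strMap_parity hodd f n p 0 (by omega) hfk' w (by simpa [prt] using hw)
  have hF1 : ∀ w ∈ V1, F w ∈ stringPart k n p 1 := fun w hw =>
    strMap_parity hodd f n p 1 (by omega) hfk' w (by simpa [prt] using hw)
  set G := Fintype.linearCombination k (fun i : Fin (n + 1) => (x ^ (i : ℕ)) v) with hG
  have hinj : Function.Injective (F ∘ₗ G) := by
    rw [← LinearMap.ker_eq_bot, LinearMap.ker_eq_bot']
    intro c hc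
    exact comb_inj x f n v (hzero v hvW) hfv c hc
  have hsurj : Function.Surjective (F ∘ₗ G) := LinearMap.injective_iff_surjective.1 hinj
  set U := LinearMap.range G with hU
  have hUs : U = Submodule.span k (Set.range fun i : Fin (n + 1) => (x ^ (i : ℕ)) v) :=
    Fintype.range_linearCombination k _
  have hUi : ∀ i : ℕ, (x ^ i) v ∈ U := by
    intro i
    by_cases hi : i < n + 1
    · rw [hUs]; exact Submodule.subset_span ⟨⟨i, hi⟩, rfl⟩
    · rw [show i = (i - (n + 1)) + (n + 1) by omega, pow_add, Module.End.mul_apply,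
        hzero v hvW, map_zero]
      exact U.zero_mem
  have hUW : U ≤ W := by
    rw [hUs, Submodule.span_le]
    rintro _ ⟨i, rfl⟩
    exact hWp _ _ hvW
  have hUx : ∀ w ∈ U, x w ∈ U := by
    have : U ≤ U.comap x := by
      conv_lhs => rw [hUs]
      rw [Submodule.span_le]
      rintro _ ⟨i, rfl⟩
      have := hUi (i + 1)
      rwa [pow_succ', Module.End.mul_apply] at this
    exact this
  have hUg : U ≤ (U ⊓ V0) ⊔ (U ⊓ V1) := by
    conv_lhs => rw [hUs]
    rw [Submodule.span_le]
    rintro _ ⟨i, rfl⟩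
    have h1 := hUi i
    have h2 := prt_pow hodd i p hvp
    unfold prt at h2
    split_ifs at h2
    · exact Submodule.mem_sup_left ⟨h1, h2⟩
    · exact Submodule.mem_sup_right ⟨h1, h2⟩
  have hUF : ∀ u ∈ U, F u = 0 → u = 0 := by
    rintro _ ⟨c, rfl⟩ hc
    have : c = 0 := hinj (by simpa using hc)
    rw [this, map_zero]
  have hbij : Function.Bijective (F ∘ₗ U.subtype) := by
    constructor
    · rw [← LinearMap.ker_eq_bot, LinearMap.ker_eq_bot']
      intro u hu
      exact Subtype.ext (hUF u u.2 hu)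
    · intro y
      obtain ⟨c, hc⟩ := hsurj y
      exact ⟨⟨G c, c, rfl⟩, hc⟩
  have hdisj : Disjoint U (W ⊓ LinearMap.ker F) := by
    rw [Submodule.disjoint_def]
    intro u hu hu'
    exact hUF u hu hu'.2
  have hsup : U ⊔ (W ⊓ LinearMap.ker F) = W := by
    refine le_antisymm (sup_le hUW inf_le_left) fun w hw => ?_
    obtain ⟨c, hc⟩ := hsurj (F w)
    have hGc : G c ∈ U := ⟨c, rfl⟩
    refine Submodule.mem_sup.2 ⟨G c, hGc, w - G c, ⟨W.sub_mem hw (hUW hGc), ?_⟩, by abel⟩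
    rw [SetLike.mem_coe, LinearMap.mem_ker, map_sub, ← hc]
    exact sub_self _
  refine ⟨U, W ⊓ LinearMap.ker F, ⟨le_antisymm hUg (sup_le inf_le_left inf_le_left), hUx, n, p, hp,
    trivial, LinearEquiv.ofBijective _ hbij, ?_, ?_, ?_⟩, ?_, ?_, ?_, hdisj, hsup⟩
  · exact fun w hw => hF0 w hw
  · exact fun w hw => hF1 w hw
  · exact fun w => strMap_shift x f n w (hzero w (hUW w.2))
  · intro w hw
    refine ⟨hW w hw.1, ?_⟩
    rw [SetLike.mem_coe, LinearMap.mem_ker, hF, strMap_shift x f n w (hzero w hw.1), ← hF,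
      LinearMap.mem_ker.1 hw.2, map_zero]
  · intro w hw
    obtain ⟨a, ha, b, hb, rfl⟩ := Submodule.mem_sup.1 (hg hw.1)
    have hab : F a + F b = 0 := by rw [← map_add]; exact hw.2
    have h0 := hF0 a ha.2
    have h1 := hF1 b hb.2
    unfold stringPart at h0 h1
    rw [Submodule.mem_pi] at h0 h1
    have hFa : F a = 0 := by
      funext j
      have e0 := h0 j trivial
      have e1 := h1 j trivial
      by_cases hj : ((j : ℕ) + p) % 2 = 0
      · rw [if_neg (by omega), Submodule.mem_bot] at e1
        have := congrFun hab j
        rw [Pi.add_apply, e1, add_zero] at this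
        exact this
      · rw [if_neg hj, Submodule.mem_bot] at e0
        exact e0
    have hFb : F b = 0 := by rwa [hFa, zero_add] at hab
    exact Submodule.mem_sup.2 ⟨a, ⟨⟨ha.1, hFa⟩, ha.2⟩, b, ⟨⟨hb.1, hFb⟩, hb.2⟩, rfl⟩
  · refine lt_of_le_of_ne inf_le_left fun he => hvn ?_
    rw [he] at hdisj
    have := Submodule.disjoint_def.1 hdisj v (by simpa using hUi 0) hvW
    rw [this, map_zero]

lemma decomp_aux [FiniteDimensional k V] {V0 V1 : Submodule k V} (hcompl : IsCompl V0 V1)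
    {x : V →ₗ[k] V} (hodd : IsOddMap k V0 V1 x) (hnil : IsNilpotent x) (W : Submodule k V) :
    (∀ w ∈ W, x w ∈ W) → (W ≤ (W ⊓ V0) ⊔ (W ⊓ V1)) →
    ∃ s : Finset (Submodule k V), s.SupIndep id ∧ s.sup id = W ∧ ∀ U ∈ s, IsStr V0 V1 x U := by
  classical
  induction W using WellFoundedLT.induction with
  | _ W ih =>
    intro hW hg
    by_cases hne : W = ⊥
    · exact ⟨∅, Finset.supIndep_empty _, by simp [hne], by simp⟩
    · obtain ⟨U, W', hU, hW', hg', hlt, hd, hs⟩ := split_one hcompl hodd hnil W hW hg hne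
      obtain ⟨s, h1, h2, h3⟩ := ih W' hlt hW' hg'
      refine ⟨insert U s, h1.insert ?_, ?_, ?_⟩
      · rw [h2]; exact hd
      · rw [Finset.sup_insert, h2]; exact hs
      · intro U' hU'
        rcases Finset.mem_insert.1 hU' with rfl | h
        · exact hU
        · exact h3 _ h

end Helpers

/-- **Classification of finite-dimensional representations of `𝔾ₐ^{(1|1)}`**: any vector
superspace `V` with an odd nilpotent endomorphism `x` decomposes into a direct sum of
`x`-invariant graded subspaces, each isomorphic as a pair to some string `Π^ε M_n`. -/
theorem decompose_into_strings {k : Type*} [Field k]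
    (V : Type*) [AddCommGroup V] [Module k V] [FiniteDimensional k V]
    (V0 V1 : Submodule k V) (hcompl : IsCompl V0 V1)
    (x : V →ₗ[k] V) (hodd : IsOddMap k V0 V1 x) (hnil : IsNilpotent x) :
    DecomposesIntoStrings k V0 V1 x (fun _ => True) := by
  classical
  obtain ⟨s, h1, h2, h3⟩ := decomp_aux hcompl hodd hnil ⊤ (fun _ _ => trivial) (by
    rw [top_inf_eq, top_inf_eq, hcompl.sup_eq_top])
  refine ⟨s.card, fun i => (s.equivFin.symm i : Submodule k V), ?_, fun i => ?_⟩
  · apply DirectSum.isInternal_submodule_of_iSupIndep_of_iSup_eq_top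
    · exact (Finset.SupIndep.independent h1).comp s.equivFin.symm.injective
    · rw [Equiv.iSup_comp s.equivFin.symm (g := fun U : s => (U : Submodule k V)), ← h2,
        Finset.sup_eq_iSup, iSup_subtype]
      rfl
  · exact h3 _ (s.equivFin.symm i).2
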